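/- Let {P₀, …, P_m} be a symmetric Clifford system on ℝ^{2l}, 0 ≤ i ≤ m−1, and let y ∈ S^{2l−1} satisfy P_{i+1}y = y and ⟨P_αy, y⟩ = 0 for all 0 ≤ α ≤ i. Let z, v ∈ ℝ^{2l} be unit vectors with ⟨z, v⟩ = 0, P_{i+1}z = −z, P_{i+1}v = −v, and ⟨z, P_αy⟩ = ⟨v, P_αy⟩ = 0 for all 0 ≤ α ≤ i. Then the curve c(t) := (y + (cos t)z + (sin t)v)/√2 lies in M_{i+1} for every t ∈ ℝ, and its second derivative satisfies c''(t) = ½(P_{i+1}c(t) − c(t)); in particular c''(t) lies in the span of {c(t), P₀c(t), …, P_{i+1}c(t)}, the normal space of M_{i+1} in ℝ^{2l} at c(t). (Hence the fibers of the focal map φ_{π/4} are totally geodesic in M_{i+1}.) -/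

import Mathlib

open Matrix Real

theorem Matrix.IsSymm.mulVec_dotProduct {n : Type*} [Fintype n] {A : Matrix n n ℝ}
    (hA : A.IsSymm) (a b : n → ℝ) : A *ᵥ a ⬝ᵥ b = a ⬝ᵥ A *ᵥ b := by
  rw [dotProduct_mulVec, ← mulVec_transpose, hA.eq]

/-- Eigenvectors of a symmetric matrix for the eigenvalues `1` and `-1` are orthogonal. -/
theorem Matrix.IsSymm.dotProduct_eq_zero_of_mulVec_eq_neg {n : Type*} [Fintype n]
    {A : Matrix n n ℝ} (hA : A.IsSymm) {a b : n → ℝ} (ha : A *ᵥ a = a) (hb : A *ᵥ b = -b) :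
    a ⬝ᵥ b = 0 := by
  have h := hA.mulVec_dotProduct a b
  rw [ha, hb, dotProduct_neg] at h
  linarith

/-- If `A` and `B` anticommute, then `A` maps the `-1`-eigenspace of `B` to its
`1`-eigenspace. -/
theorem Matrix.mulVec_mulVec_eq_of_anticommute {n : Type*} [Fintype n]
    {A B : Matrix n n ℝ} (hAB : A * B + B * A = 0) {b : n → ℝ} (hb : B *ᵥ b = -b) :
    B *ᵥ (A *ᵥ b) = A *ᵥ b := by
  rw [mulVec_mulVec, eq_neg_of_add_eq_zero_right hAB, neg_mulVec, ← mulVec_mulVec, hb,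
    mulVec_neg, neg_neg]

theorem hasDerivAt_smul_add_cos_smul_add_sin_smul {E : Type*} [NormedAddCommGroup E]
    [NormedSpace ℝ E] (k : ℝ) (y z v : E) (t : ℝ) :
    HasDerivAt (fun t : ℝ => k • (y + Real.cos t • z + Real.sin t • v))
      (k • (0 + Real.cos t • v + Real.sin t • -z)) t := by
  have h := ((((Real.hasDerivAt_cos t).smul_const z).const_add y).add
    ((Real.hasDerivAt_sin t).smul_const v)).const_smul k
  refine HasDerivAt.congr_deriv h ?_
  module

/-- For a symmetric Clifford system `{P₀, …, P_m}` on `ℝ^{2l}`, `0 ≤ i ≤ m-1`,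
`y ∈ S^{2l-1}` with `P_{i+1}y = y` and `⟨P_αy, y⟩ = 0` (`0 ≤ α ≤ i`), and
orthonormal `z, v` with `P_{i+1}z = -z`, `P_{i+1}v = -v`,
`⟨z, P_αy⟩ = ⟨v, P_αy⟩ = 0` (`0 ≤ α ≤ i`): the curve
`c(t) = (y + (cos t) z + (sin t) v)/√2` lies in `M_{i+1}`, and
`c''(t) = ½ (P_{i+1} c(t) - c(t))`; in particular `c''(t)` lies in the span of
`{c(t), P₀c(t), …, P_{i+1}c(t)}`. -/
theorem stmt_11 (l m i : ℕ) (hi : i + 1 ≤ m)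
    (P : ℕ → Matrix (Fin (2 * l)) (Fin (2 * l)) ℝ)
    (hs : ∀ α ≤ m, (P α).IsSymm)
    (hc : ∀ α ≤ m, ∀ β ≤ m,
      P α * P β + P β * P α = if α = β then (2 : ℝ) • 1 else 0)
    (y z v : Fin (2 * l) → ℝ)
    (hy : y ⬝ᵥ y = 1) (hy1 : (P (i + 1)).mulVec y = y)
    (hy0 : ∀ α ≤ i, (P α).mulVec y ⬝ᵥ y = 0)
    (hz : z ⬝ᵥ z = 1) (hv : v ⬝ᵥ v = 1) (hzv : z ⬝ᵥ v = 0)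
    (hz1 : (P (i + 1)).mulVec z = -z) (hv1 : (P (i + 1)).mulVec v = -v)
    (hz0 : ∀ α ≤ i, z ⬝ᵥ (P α).mulVec y = 0)
    (hv0 : ∀ α ≤ i, v ⬝ᵥ (P α).mulVec y = 0)
    (c : ℝ → (Fin (2 * l) → ℝ))
    (hcurve : c = fun t => (Real.sqrt 2)⁻¹ • (y + Real.cos t • z + Real.sin t • v)) :
    ∀ t : ℝ,
      (c t ⬝ᵥ c t = 1 ∧ ∀ α ≤ i + 1, (P α).mulVec (c t) ⬝ᵥ c t = 0) ∧
      deriv (deriv c) t = (2 : ℝ)⁻¹ • ((P (i + 1)).mulVec (c t) - c t) ∧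
      deriv (deriv c) t ∈ Submodule.span ℝ
        ({c t} ∪ {w : Fin (2 * l) → ℝ | ∃ α ≤ i + 1, w = (P α).mulVec (c t)}) := by
  intro t
  have hQ := hs (i + 1) hi
  obtain ⟨w, hw⟩ : ∃ w, w = Real.cos t • z + Real.sin t • v := ⟨_, rfl⟩
  have hct : c t = (Real.sqrt 2)⁻¹ • (y + w) := by rw [hcurve, hw, ← add_assoc]
  have hQw : P (i + 1) *ᵥ w = -w := by
    rw [hw, mulVec_add, mulVec_smul, mulVec_smul, hz1, hv1]
    module
  have hww : w ⬝ᵥ w = 1 := by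
    have hvz : v ⬝ᵥ z = 0 := by rw [dotProduct_comm, hzv]
    simp only [hw, add_dotProduct, dotProduct_add, smul_dotProduct, dotProduct_smul, hz, hv, hzv,
      hvz, smul_eq_mul]
    linarith [Real.sin_sq_add_cos_sq t]
  have hyw : y ⬝ᵥ w = 0 := hQ.dotProduct_eq_zero_of_mulVec_eq_neg hy1 hQw
  have hwy : w ⬝ᵥ y = 0 := by rw [dotProduct_comm, hyw]
  have hk : (Real.sqrt 2)⁻¹ * (Real.sqrt 2)⁻¹ = (2 : ℝ)⁻¹ := by
    rw [← mul_inv, Real.mul_self_sqrt zero_le_two]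
  have hderiv : deriv (deriv c) t = (2 : ℝ)⁻¹ • ((P (i + 1)).mulVec (c t) - c t) := by
    have hc' : deriv c =
        fun t => (Real.sqrt 2)⁻¹ • (0 + Real.cos t • v + Real.sin t • -z) := by
      rw [hcurve]
      exact funext fun s => (hasDerivAt_smul_add_cos_smul_add_sin_smul _ y z v s).deriv
    rw [hc', (hasDerivAt_smul_add_cos_smul_add_sin_smul _ 0 v (-z) t).deriv, hct, mulVec_smul,
      mulVec_add, hy1, hQw, hw]
    module
  refine ⟨⟨?_, fun α hα => ?_⟩, hderiv, ?_⟩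
  · rw [hct, smul_dotProduct, dotProduct_smul, smul_smul, hk, add_dotProduct, dotProduct_add,
      dotProduct_add, hy, hww, hyw, hwy]
    norm_num
  · rw [hct, mulVec_smul, smul_dotProduct, dotProduct_smul, mulVec_add, add_dotProduct,
      dotProduct_add, dotProduct_add]
    rcases Nat.le_succ_iff.mp hα with hα | rfl
    · have hαm : α ≤ m := by omega
      have hanti : P α * P (i + 1) + P (i + 1) * P α = 0 := by
        rw [hc α hαm (i + 1) hi, if_neg (by omega)]
      have hPww : P α *ᵥ w ⬝ᵥ w = 0 :=
        hQ.dotProduct_eq_zero_of_mulVec_eq_neg (mulVec_mulVec_eq_of_anticommute hanti hQw) hQw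
      have hwPy : w ⬝ᵥ P α *ᵥ y = 0 := by
        simp [hw, add_dotProduct, hz0 α hα, hv0 α hα]
      rw [hPww, hy0 α hα, (hs α hαm).mulVec_dotProduct w y, dotProduct_comm _ w, hwPy]
      simp
    · rw [Nat.succ_eq_add_one, hy1, hQw, neg_dotProduct, neg_dotProduct, hy, hww, hyw, hwy]
      simp
  · rw [hderiv]
    exact Submodule.smul_mem _ _ (Submodule.sub_mem _
      (Submodule.subset_span (Or.inr ⟨i + 1, le_rfl, rfl⟩))
      (Submodule.subset_span (Or.inl rfl)))
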